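/- For every complex number s with Re(s) > 2, one has Z_13(s) = (13/2)·Z_12(s) − (143/2)·Z_10(s) + (1287/2)·Z_8(s) − (7293/2)·Z_6(s) + (22165/2)·Z_4(s) − (26949/2)·Z_2(s) + (5461/2)·Z_0(s). -/

import Mathlib

/-- The Euler–Zagier double zeta function `ζ(-c, s+c) = ∑_{m,n ≥ 1} m^c / (m+n)^(s+c)`. -/
noncomputable def Z (c : ℕ) (s : ℂ) : ℂ :=
  ∑' p : ℕ+ × ℕ+, ((p.1 : ℕ) : ℂ) ^ c / ((((p.1 : ℕ) + (p.2 : ℕ) : ℕ)) : ℂ) ^ (s + (c : ℂ))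

/-- The summand of `Z c s` is a power of the ratio `m / (m + n)` times a weight symmetric
in `m` and `n`. -/
lemma Z_term_eq (c : ℕ) (s : ℂ) (p : ℕ+ × ℕ+) :
    ((p.1 : ℕ) : ℂ) ^ c / ((((p.1 : ℕ) + (p.2 : ℕ) : ℕ)) : ℂ) ^ (s + (c : ℂ)) =
      (((p.1 : ℕ) : ℂ) / (((p.1 : ℕ) : ℂ) + ((p.2 : ℕ) : ℂ))) ^ c *
        ((((p.1 : ℕ) + (p.2 : ℕ) : ℕ)) : ℂ) ^ (-s) := by
  have h : ((((p.1 : ℕ) + (p.2 : ℕ) : ℕ)) : ℂ) ≠ 0 := by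
    have := p.1.pos
    exact Nat.cast_ne_zero.mpr (by omega)
  rw [Complex.cpow_add _ _ h, Complex.cpow_natCast, Complex.cpow_neg, div_pow, Nat.cast_add]
  simp only [div_eq_mul_inv, mul_inv]
  ring

/-- The double series `∑ (m + n) ^ (-σ)` converges for `σ > 2`. -/
lemma summable_add_rpow_neg {σ : ℝ} (hσ : 2 < σ) :
    Summable fun p : ℕ+ × ℕ+ => ((((p.1 : ℕ) + (p.2 : ℕ) : ℕ)) : ℝ) ^ (-σ) := by
  have h1 : Summable fun n : ℕ+ => ((n : ℕ) : ℝ) ^ (-(σ / 2)) :=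
    (Real.summable_nat_rpow.mpr (by linarith)).comp_injective PNat.coe_injective
  refine Summable.of_nonneg_of_le (fun p => by positivity) (fun p => ?_)
    (h1.mul_of_nonneg h1 (fun _ => by positivity) (fun _ => by positivity))
  have hm : (0 : ℝ) < ((p.1 : ℕ) : ℝ) := Nat.cast_pos.mpr p.1.pos
  have hn : (0 : ℝ) < ((p.2 : ℕ) : ℝ) := Nat.cast_pos.mpr p.2.pos
  rw [Nat.cast_add, show -σ = -(σ / 2) + -(σ / 2) by ring, Real.rpow_add (by positivity)]
  exact mul_le_mul
    (Real.rpow_le_rpow_of_nonpos hm (by linarith) (by linarith))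
    (Real.rpow_le_rpow_of_nonpos hn (by linarith) (by linarith))
    (by positivity) (by positivity)

lemma hasSum_Z (c : ℕ) {s : ℂ} (hs : 2 < s.re) :
    HasSum (fun p : ℕ+ × ℕ+ => (((p.1 : ℕ) : ℂ) / (((p.1 : ℕ) : ℂ) + ((p.2 : ℕ) : ℂ))) ^ c *
        ((((p.1 : ℕ) + (p.2 : ℕ) : ℕ)) : ℂ) ^ (-s)) (Z c s) := by
  rw [Z, tsum_congr (Z_term_eq c s)]
  refine (Summable.of_norm_bounded (summable_add_rpow_neg hs) fun p => ?_).hasSum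
  have hpos : 0 < (p.1 : ℕ) + (p.2 : ℕ) := Nat.add_pos_left p.1.pos _
  rw [norm_mul, Complex.norm_natCast_cpow_of_pos hpos, Complex.neg_re, norm_pow]
  refine mul_le_of_le_one_left (by positivity) (pow_le_one₀ (norm_nonneg _) ?_)
  rw [← Nat.cast_add, norm_div, Complex.norm_natCast, Complex.norm_natCast]
  exact div_le_one_of_le₀ (by push_cast; linarith [Nat.cast_nonneg (α := ℝ) (p.2 : ℕ)])
    (by positivity)

theorem zeta_neg_thirteen_relation (s : ℂ) (hs : 2 < s.re) :
    Z 13 s = (13 / 2) * Z 12 s - (143 / 2) * Z 10 s + (1287 / 2) * Z 8 s - (7293 / 2) * Z 6 s + (22165 / 2) * Z 4 s - (26949 / 2) * Z 2 s + (5461 / 2) * Z 0 s := by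
  have key := (hasSum_Z 13 hs).sub ((((((((hasSum_Z 12 hs).mul_left (13 / 2)).sub
    ((hasSum_Z 10 hs).mul_left (143 / 2))).add ((hasSum_Z 8 hs).mul_left (1287 / 2))).sub
    ((hasSum_Z 6 hs).mul_left (7293 / 2))).add ((hasSum_Z 4 hs).mul_left (22165 / 2))).sub
    ((hasSum_Z 2 hs).mul_left (26949 / 2))).add ((hasSum_Z 0 hs).mul_left (5461 / 2)))
  have swapped := (Equiv.prodComm ℕ+ ℕ+).hasSum_iff.mpr key
  -- The combination is the Euler polynomial of degree 13, which is odd under `x ↦ 1 - x`.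
  have odd : ∀ x y w : ℂ, x + y = 1 →
      y ^ 13 * w - (13 / 2 * (y ^ 12 * w) - 143 / 2 * (y ^ 10 * w) + 1287 / 2 * (y ^ 8 * w)
        - 7293 / 2 * (y ^ 6 * w) + 22165 / 2 * (y ^ 4 * w) - 26949 / 2 * (y ^ 2 * w)
        + 5461 / 2 * (y ^ 0 * w)) =
      -(x ^ 13 * w - (13 / 2 * (x ^ 12 * w) - 143 / 2 * (x ^ 10 * w) + 1287 / 2 * (x ^ 8 * w)
        - 7293 / 2 * (x ^ 6 * w) + 22165 / 2 * (x ^ 4 * w) - 26949 / 2 * (x ^ 2 * w)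
        + 5461 / 2 * (x ^ 0 * w))) := by
    intro x y w h
    obtain rfl : y = 1 - x := by linear_combination h
    ring
  rw [show _ ∘ _ = _ from funext fun p => ?_] at swapped
  have eq := swapped.unique key.neg
  · linear_combination eq / 2
  have h : ((p.1 : ℕ) : ℂ) + ((p.2 : ℕ) : ℂ) ≠ 0 := by
    rw [← Nat.cast_add]
    exact Nat.cast_ne_zero.mpr (Nat.add_pos_left p.1.pos _).ne'
  simp only [Function.comp_apply, Equiv.prodComm_apply, Prod.fst_swap, Prod.snd_swap,
    add_comm (p.2 : ℕ) (p.1 : ℕ), add_comm ((p.2 : ℕ) : ℂ) ((p.1 : ℕ) : ℂ)]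
  exact odd _ _ _ (by rw [← add_div, div_self h])
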